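/- Let G be a κ-deletion-minimal graph with respect to total coloring, and suppose the edge ww₂ is contained in two triangles ww₁w₂ and ww₂w₃ (with w₁ ≠ w₃). If deg(w) + deg(w₂) = κ + 1 and deg(w₂) ≤ ⌊(κ−1)/2⌋, then every neighbor w₄ of w other than w₁, w₂, w₃ satisfies deg(w₄) ≥ deg(w₂) + 2 or deg(w₄) ≥ ⌊(κ+1)/2⌋. -/

import Mathlib

open SimpleGraph

variable {V : Type*}

/-- The degree of a vertex, defined via the cardinality of its neighbor set. -/
noncomputable def deg (G : SimpleGraph V) (v : V) : ℕ := (G.neighborSet v).ncard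

/-- The maximum degree of a graph. -/
noncomputable def maxDeg (G : SimpleGraph V) : ℕ := ⨆ v, deg G v

/-- `fv` colors the vertices and `fe` colors the edges; together they form a total
coloring: adjacent vertices get distinct colors, distinct edges sharing a vertex get
distinct colors, and a vertex gets a color distinct from every edge incident to it. -/
def IsTotalColoring (G : SimpleGraph V) {α : Type*} (fv : V → α) (fe : Sym2 V → α) : Prop :=
  (∀ u v : V, G.Adj u v → fv u ≠ fv v) ∧
  (∀ e₁ e₂ : Sym2 V, e₁ ∈ G.edgeSet → e₂ ∈ G.edgeSet → e₁ ≠ e₂ →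
      (∃ w : V, w ∈ e₁ ∧ w ∈ e₂) → fe e₁ ≠ fe e₂) ∧
  (∀ (v : V) (e : Sym2 V), e ∈ G.edgeSet → v ∈ e → fv v ≠ fe e)

/-- `G` has a total coloring with `n` colors. -/
def HasTotalColoring (G : SimpleGraph V) (n : ℕ) : Prop :=
  ∃ (fv : V → Fin n) (fe : Sym2 V → Fin n), IsTotalColoring G fv fe

/-- The total chromatic number of `G`. -/
noncomputable def totalChromaticNumber (G : SimpleGraph V) : ℕ :=
  sInf {n | HasTotalColoring G n}

/-- A `κ`-deletion-minimal graph: maximum degree at most `κ - 1`, total chromatic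
number greater than `κ`, but every proper subgraph has total chromatic number at most `κ`. -/
def DeletionMinimal (κ : ℕ) (G : SimpleGraph V) : Prop :=
  (∀ v : V, deg G v ≤ κ - 1) ∧ κ < totalChromaticNumber G ∧
  ∀ H : SimpleGraph V, H < G → totalChromaticNumber H ≤ κ

/-- `fv` and `c` satisfy all constraints of a total coloring of `H` except those involving the
colors of the vertices in `L`. -/
def IsPartialTotalColoring (H : SimpleGraph V) {α : Type*} (L : Set V) (fv : V → α)
    (c : Sym2 V → α) : Prop :=
  (∀ u v, H.Adj u v → u ∉ L → v ∉ L → fv u ≠ fv v) ∧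
  (∀ v x y, H.Adj v x → H.Adj v y → x ≠ y → c s(v, x) ≠ c s(v, y)) ∧
  (∀ v x, H.Adj v x → v ∉ L → fv v ≠ c s(v, x))

theorem IsTotalColoring.isPartialTotalColoring {H : SimpleGraph V} {α : Type*} {fv : V → α}
    {c : Sym2 V → α} (h : IsTotalColoring H fv c) (L : Set V) :
    IsPartialTotalColoring H L fv c := by
  obtain ⟨h1, h2, h3⟩ := h
  refine ⟨fun u v huv _ _ => h1 u v huv, fun v x y hx hy hxy => ?_, fun v x hx _ => ?_⟩
  · exact h2 _ _ hx hy (fun he => hxy (Sym2.congr_right.1 he)) ⟨v, by simp, by simp⟩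
  · exact h3 v _ hx (by simp)

theorem IsPartialTotalColoring.isTotalColoring {H : SimpleGraph V} {α : Type*} {fv : V → α}
    {c : Sym2 V → α} (h : IsPartialTotalColoring H ∅ fv c) : IsTotalColoring H fv c := by
  obtain ⟨h1, h2, h3⟩ := h
  refine ⟨fun u v huv => h1 u v huv (by simp) (by simp), ?_, ?_⟩
  · rintro e₁ e₂ he₁ he₂ hne ⟨v, hv₁, hv₂⟩
    obtain ⟨x, rfl⟩ := hv₁
    obtain ⟨y, rfl⟩ := hv₂
    exact h2 v x y he₁ he₂ (fun h => hne (by rw [h]))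
  · rintro v e he ⟨x, rfl⟩
    exact h3 v x he (by simp)

theorem HasTotalColoring.mono {H : SimpleGraph V} {m n : ℕ} (h : HasTotalColoring H m)
    (hmn : m ≤ n) : HasTotalColoring H n := by
  obtain ⟨fv, c, h1, h2, h3⟩ := h
  have hi := Fin.castLE_injective hmn
  exact ⟨Fin.castLE hmn ∘ fv, Fin.castLE hmn ∘ c, fun u v huv => hi.ne (h1 u v huv),
    fun e₁ e₂ he₁ he₂ hne hw => hi.ne (h2 e₁ e₂ he₁ he₂ hne hw),
    fun v e he hv => hi.ne (h3 v e he hv)⟩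

theorem exists_hasTotalColoring [Fintype V] (H : SimpleGraph V) : ∃ n, HasTotalColoring H n := by
  classical
  let e := Fintype.equivFin (V ⊕ Sym2 V)
  refine ⟨_, e ∘ Sum.inl, e ∘ Sum.inr, fun u v huv => ?_, fun _ _ _ _ hne _ => ?_,
    fun v x _ _ => ?_⟩
  · simpa using huv.ne
  · simpa using hne
  · simp

theorem hasTotalColoring_of_totalChromaticNumber_le [Fintype V] {H : SimpleGraph V} {n : ℕ}
    (h : totalChromaticNumber H ≤ n) : HasTotalColoring H n :=
  HasTotalColoring.mono (Nat.sInf_mem (exists_hasTotalColoring H)) h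

theorem DeletionMinimal.not_hasTotalColoring {κ : ℕ} {G : SimpleGraph V}
    (hG : DeletionMinimal κ G) : ¬ HasTotalColoring G κ :=
  fun h => (Nat.sInf_le h).not_gt hG.2.1

theorem DeletionMinimal.hasTotalColoring_deleteEdges [Fintype V] {κ : ℕ} {G : SimpleGraph V}
    (hG : DeletionMinimal κ G) {u v : V} (huv : G.Adj u v) :
    HasTotalColoring (G.deleteEdges {s(u, v)}) κ := by
  refine hasTotalColoring_of_totalChromaticNumber_le (hG.2.2 _ ?_)
  refine lt_of_le_of_ne (G.deleteEdges_le _) fun h => ?_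
  rw [← h] at huv
  simp at huv

open Classical in
theorem deg_eq_card_neighborFinset [Fintype V] (G : SimpleGraph V) (v : V) :
    deg G v = (G.neighborFinset v).card := by
  rw [deg, Set.ncard_eq_toFinset_card']
  rfl

open Classical in
theorem card_neighborFinset_erase [Fintype V] {G : SimpleGraph V} {v u : V} (h : G.Adj v u) :
    ((G.neighborFinset v).erase u).card + 1 = deg G v := by
  rw [Finset.card_erase_add_one (by simpa using h), deg_eq_card_neighborFinset]

open Classical in
/-- A vertex with few neighbors can be colored after everything else. -/
theorem IsPartialTotalColoring.exists_color [Fintype V] {G : SimpleGraph V} {κ : ℕ} {a : V}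
    {L : Set V} {fv : V → Fin κ} {c : Sym2 V → Fin κ}
    (h : IsPartialTotalColoring G (insert a L) fv c) (ha : 2 * deg G a < κ) :
    ∃ fv' : V → Fin κ, IsPartialTotalColoring G L fv' c := by
  obtain ⟨h1, h2, h3⟩ := h
  let A := (G.neighborFinset a).image fv ∪ (G.neighborFinset a).image fun x => c s(a, x)
  have hA : A.card < (Finset.univ : Finset (Fin κ)).card := by
    have k1 := Finset.card_image_le (s := G.neighborFinset a) (f := fv)
    have k2 := Finset.card_image_le (s := G.neighborFinset a) (f := fun x => c s(a, x))
    have k3 : A.card ≤ _ := Finset.card_union_le _ _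
    rw [deg_eq_card_neighborFinset] at ha
    rw [Finset.card_fin]
    lia
  obtain ⟨μ, -, hμ⟩ := Finset.exists_mem_notMem_of_card_lt_card hA
  have hv : ∀ x, G.Adj a x → fv x ≠ μ := fun x hx hxμ =>
    hμ (Finset.mem_union_left _ (Finset.mem_image.2 ⟨x, by simpa using hx, hxμ⟩))
  have he : ∀ x, G.Adj a x → c s(a, x) ≠ μ := fun x hx hxμ =>
    hμ (Finset.mem_union_right _ (Finset.mem_image.2 ⟨x, by simpa using hx, hxμ⟩))
  refine ⟨Function.update fv a μ, fun u v huv hu hv' => ?_, h2, fun v x hx hv' => ?_⟩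
  · rcases eq_or_ne u a with rfl | hua
    · rw [Function.update_self, Function.update_of_ne huv.ne']
      exact (hv v huv).symm
    rcases eq_or_ne v a with rfl | hva
    · rw [Function.update_self, Function.update_of_ne hua]
      exact hv u huv.symm
    rw [Function.update_of_ne hua, Function.update_of_ne hva]
    exact h1 u v huv (by simp [hua, hu]) (by simp [hva, hv'])
  · rcases eq_or_ne v a with rfl | hva
    · rw [Function.update_self]
      exact (he x hx).symm
    rw [Function.update_of_ne hva]
    exact h3 v x hx (by simp [hva, hv'])

theorem IsPartialTotalColoring.hasTotalColoring [Fintype V] {G : SimpleGraph V} {κ : ℕ} {a b : V}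
    {fv : V → Fin κ} {c : Sym2 V → Fin κ} (h : IsPartialTotalColoring G {a, b} fv c)
    (ha : 2 * deg G a < κ) (hb : 2 * deg G b < κ) : HasTotalColoring G κ := by
  obtain ⟨f, hf⟩ := h.exists_color ha
  rw [← insert_empty_eq] at hf
  obtain ⟨g, hg⟩ := hf.exists_color hb
  exact ⟨g, c, hg.isTotalColoring⟩

open Classical in
/-- If the coloring does not extend to the missing edge `wx`, then each color missing at `w`
appears on an edge at `x`. -/
theorem IsPartialTotalColoring.exists_edge_color {G : SimpleGraph V} {α : Type*} {L : Set V}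
    {fv : V → α} {c : Sym2 V → α} {w x : V}
    (h : IsPartialTotalColoring (G.deleteEdges {s(w, x)}) L fv c)
    (hG : ∀ c' : Sym2 V → α, ¬ IsPartialTotalColoring G L fv c') (hwx : G.Adj w x)
    (hx : x ∈ L) {μ : α} (hv : fv w ≠ μ) (he : ∀ y, G.Adj w y → y ≠ x → c s(w, y) ≠ μ) :
    ∃ y, G.Adj x y ∧ y ≠ w ∧ c s(x, y) = μ := by
  by_contra! hne
  obtain ⟨h1, h2, h3⟩ := h
  simp only [deleteEdges_adj, Set.mem_singleton_iff, Sym2.eq_iff] at h1 h2 h3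
  have hn := hwx.ne
  refine hG (Function.update c s(w, x) μ) ⟨fun u v huv hu hv => ?_, fun v y z hy hz hyz => ?_,
    fun v y hy hvL => ?_⟩
  · exact h1 u v ⟨huv, by grind⟩ hu hv
  · simp only [Function.update_apply, Sym2.eq_iff]
    grind
  · simp only [Function.update_apply, Sym2.eq_iff]
    grind

open Classical in
/-- Moving a color from the edge `wy` to the missing edge `wx`. -/
theorem IsPartialTotalColoring.shift {G : SimpleGraph V} {α : Type*} {L : Set V}
    {fv : V → α} {c : Sym2 V → α} {w x y : V}
    (h : IsPartialTotalColoring (G.deleteEdges {s(w, x)}) L fv c) (hx : x ∈ L)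
    (hwx : G.Adj w x) (hwy : G.Adj w y) (hxy : x ≠ y)
    (hd : ∀ z, G.Adj x z → z ≠ w → c s(w, y) ≠ c s(x, z)) :
    IsPartialTotalColoring (G.deleteEdges {s(w, y)}) L fv
      (Function.update c s(w, x) (c s(w, y))) := by
  obtain ⟨h1, h2, h3⟩ := h
  simp only [deleteEdges_adj, Set.mem_singleton_iff, Sym2.eq_iff] at h1 h2 h3
  have hn := hwx.ne
  have hn' := hwy.ne
  refine ⟨fun u v huv hu hv => ?_, fun v p q hp hq hpq => ?_, fun v p hp hvL => ?_⟩ <;>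
    simp only [deleteEdges_adj, Set.mem_singleton_iff, Sym2.eq_iff] at *
  · exact h1 u v ⟨huv.1, by grind⟩ hu hv
  · simp only [Function.update_apply, Sym2.eq_iff]
    grind
  · simp only [Function.update_apply, Sym2.eq_iff]
    grind

open Classical in
/-- Exchanging the colors of the two present edges of the triangle `wux`, where `wx` is missing. -/
theorem IsPartialTotalColoring.swap {G : SimpleGraph V} {α : Type*} {L : Set V}
    {fv : V → α} {c : Sym2 V → α} {w x u : V}
    (h : IsPartialTotalColoring (G.deleteEdges {s(w, x)}) L fv c) (hx : x ∈ L)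
    (hwx : G.Adj w x) (hwu : G.Adj w u) (hxu : G.Adj x u)
    (hd : ∀ y z, G.Adj w y → y ≠ x → G.Adj x z → z ≠ w → c s(w, y) ≠ c s(x, z))
    (hv : ∀ z, G.Adj x z → z ≠ w → fv w ≠ c s(x, z)) :
    IsPartialTotalColoring (G.deleteEdges {s(w, x)}) L fv
      (Function.update (Function.update c s(w, u) (c s(x, u))) s(x, u) (c s(w, u))) := by
  obtain ⟨h1, h2, h3⟩ := h
  have hn1 := hwx.ne
  have hn2 := hwu.ne
  have hn3 := hxu.ne
  have hd1 := fun z => hd u z hwu hn3.symm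
  have hd2 := fun y hy hyx => hd y u hy hyx hxu hn2.symm
  have hc : ∀ a b, c s(a, b) = c s(b, a) := fun a b => by rw [Sym2.eq_swap]
  simp only [deleteEdges_adj, Set.mem_singleton_iff, Sym2.eq_iff] at h2 h3
  have hu : ∀ y, G.Adj u y → (y ≠ w → c s(w, u) ≠ c s(u, y)) ∧ (y ≠ x → c s(x, u) ≠ c s(u, y)) :=
    fun y hy => ⟨fun hyw => hc w u ▸ h2 u w y ⟨hwu.symm, by grind⟩ ⟨hy, by grind⟩ hyw.symm,
      fun hyx => hc x u ▸ h2 u x y ⟨hxu.symm, by grind⟩ ⟨hy, by grind⟩ hyx.symm⟩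
  have h3w := h3 u w ⟨hwu.symm, by grind⟩
  have h3x := h3 u x ⟨hxu.symm, by grind⟩
  rw [hc u w] at h3w
  rw [hc u x] at h3x
  have hwd := hd u u hwu hn3.symm hxu hn2.symm
  obtain ⟨f, hf⟩ : ∃ f : V → V → α, ∀ a b, c s(a, b) = f a b := ⟨_, fun _ _ => rfl⟩
  refine ⟨h1, fun v p q hp hq hpq => ?_, fun v p hp hvL => ?_⟩
  all_goals
    simp only [deleteEdges_adj, Set.mem_singleton_iff, Sym2.eq_iff] at *
    simp only [Function.update_apply, Sym2.eq_iff]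
    simp only [hf] at *
    clear hf
  · have := h2 v p q hp hq hpq
    clear h1 h2 h3 h3w h3x hc
    rcases eq_or_ne v u with rfl | hvu
    · grind
    rcases eq_or_ne v w with rfl | hvw
    · grind
    rcases eq_or_ne v x with rfl | hvx
    · grind
    grind
  · have := h3 v p hp hvL
    grind

open Classical in
/-- Counting colors: if the missing edge `wx` cannot be colored and `deg w + deg x = κ + 1`, then
no color present at `w` appears on an edge at `x`. -/
theorem IsPartialTotalColoring.disjoint [Fintype V] {G : SimpleGraph V} {κ : ℕ} {L : Set V}
    {fv : V → Fin κ} {c : Sym2 V → Fin κ} {w x : V}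
    (h : IsPartialTotalColoring (G.deleteEdges {s(w, x)}) L fv c)
    (hG : ∀ c' : Sym2 V → Fin κ, ¬ IsPartialTotalColoring G L fv c') (hwx : G.Adj w x)
    (hx : x ∈ L) (hsum : deg G w + deg G x = κ + 1) :
    Disjoint (insert (fv w) (((G.neighborFinset w).erase x).image fun y => c s(w, y)))
      (((G.neighborFinset x).erase w).image fun z => c s(x, z)) := by
  set P := insert (fv w) (((G.neighborFinset w).erase x).image fun y => c s(w, y)) with hP
  set T := ((G.neighborFinset x).erase w).image fun z => c s(x, z) with hT
  have hsub : Pᶜ ⊆ T := by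
    intro μ hμ
    simp only [hP, Finset.mem_compl, Finset.mem_insert, Finset.mem_image, Finset.mem_erase,
      mem_neighborFinset, not_or, not_exists, not_and] at hμ
    obtain ⟨z, hz, hzw, hzμ⟩ := h.exists_edge_color hG hwx hx (Ne.symm hμ.1)
      fun y hy hyx => hμ.2 y ⟨hyx, hy⟩
    exact Finset.mem_image.2 ⟨z, by simp [hz, hzw], hzμ⟩
  have k1 : P.card ≤ _ := Finset.card_insert_le _ _
  have k2 := Finset.card_image_le (s := (G.neighborFinset w).erase x) (f := fun y => c s(w, y))
  have k3 : T.card ≤ _ := Finset.card_image_le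
  have k4 := card_neighborFinset_erase hwx
  have k5 := card_neighborFinset_erase hwx.symm
  have k6 : Pᶜ.card = κ - P.card := by rw [Finset.card_compl, Fintype.card_fin]
  rw [← Finset.eq_of_subset_of_card_le hsub (by lia)]
  exact disjoint_compl_right

/-- in a κ-deletion-minimal graph, if the edge `ww₂` lies in the two
triangles `ww₁w₂` and `ww₂w₃` (with `w₁ ≠ w₃`), `deg w + deg w₂ = κ + 1` and
`deg w₂ ≤ ⌊(κ-1)/2⌋`, then every other neighbor `w₄` of `w` satisfies
`deg w₄ ≥ deg w₂ + 2` or `deg w₄ ≥ ⌊(κ+1)/2⌋`. -/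
theorem stmt_11 {V : Type*} [Fintype V] (κ : ℕ) (G : SimpleGraph V)
    (hG : DeletionMinimal κ G) (w w₁ w₂ w₃ : V) (h13 : w₁ ≠ w₃)
    (h1 : G.Adj w w₁) (h2 : G.Adj w w₂) (h3 : G.Adj w w₃)
    (h12 : G.Adj w₁ w₂) (h23 : G.Adj w₂ w₃)
    (hsum : deg G w + deg G w₂ = κ + 1) (hw2 : deg G w₂ ≤ (κ - 1) / 2) :
    ∀ w₄ : V, G.Adj w w₄ → w₄ ≠ w₁ → w₄ ≠ w₂ → w₄ ≠ w₃ →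
      deg G w₂ + 2 ≤ deg G w₄ ∨ (κ + 1) / 2 ≤ deg G w₄ := by
  classical
  intro w₄ h4 h41 h42 h43
  by_contra! hlt
  obtain ⟨hlt1, hlt2⟩ := hlt
  have p2 := card_neighborFinset_erase h2.symm
  have hnot : ∀ fv c, ¬ IsPartialTotalColoring G {w₂, w₄} fv c := fun fv c h =>
    hG.not_hasTotalColoring (h.hasTotalColoring (by lia) (by lia))
  obtain ⟨fv, c₀, hc₀⟩ := hG.hasTotalColoring_deleteEdges h2
  replace hc₀ := hc₀.isPartialTotalColoring {w₂, w₄}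
  have hm2 : w₂ ∈ ({w₂, w₄} : Set V) := by simp
  have hm4 : w₄ ∈ ({w₂, w₄} : Set V) := by simp
  have hdisj := fun c (hc : IsPartialTotalColoring (G.deleteEdges {s(w, w₂)}) {w₂, w₄} fv c) =>
    Finset.disjoint_left.1 (hc.disjoint (hnot fv) h2 hm2 hsum)
  have hd : ∀ c, IsPartialTotalColoring (G.deleteEdges {s(w, w₂)}) {w₂, w₄} fv c →
      ∀ y z, G.Adj w y → y ≠ w₂ → G.Adj w₂ z → z ≠ w → c s(w, y) ≠ c s(w₂, z) :=
    fun c hc y z hy hy2 hz hzw he => hdisj c hc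
      (Finset.mem_insert_of_mem (Finset.mem_image.2 ⟨y, by simp [hy, hy2], rfl⟩))
      (Finset.mem_image.2 ⟨z, by simp [hz, hzw], he.symm⟩)
  have hv : ∀ z, G.Adj w₂ z → z ≠ w → fv w ≠ c₀ s(w₂, z) :=
    fun z hz hzw he => hdisj c₀ hc₀ (Finset.mem_insert_self _ _)
      (Finset.mem_image.2 ⟨z, by simp [hz, hzw], he.symm⟩)
  have key : ∀ c, IsPartialTotalColoring (G.deleteEdges {s(w, w₂)}) {w₂, w₄} fv c →
      ∀ μ, fv w ≠ μ → (∀ y, G.Adj w y → y ≠ w₂ → c s(w, y) ≠ μ) →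
      ∃ z, G.Adj w₄ z ∧ z ≠ w ∧ c s(w₄, z) = μ := by
    intro c hc μ hvμ heμ
    have hs := hc.shift hm2 h2 h4 h42.symm fun z => hd c hc w₄ z h4 h42
    obtain ⟨z, hz, hzw, hzμ⟩ := hs.exists_edge_color (hnot fv) h4 hm4 hvμ fun y hy hy4 => by
      have := heμ w₄ h4 h42
      have := heμ y hy
      simp only [Function.update_apply, Sym2.eq_iff]
      grind
    have hn := h4.ne
    refine ⟨z, hz, hzw, ?_⟩
    rwa [Function.update_of_ne (by simp only [ne_eq, Sym2.eq_iff]; grind)] at hzμ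
  have hT : ∀ u, G.Adj w u → G.Adj w₂ u → w₄ ≠ u →
      ∃ z, G.Adj w₄ z ∧ z ≠ w ∧ c₀ s(w₄, z) = c₀ s(w, u) := by
    intro u hwu h2u h4u
    have hn := h4.ne
    have hn1 := h2.ne
    have hn2 := hwu.ne
    have hn3 := h2u.ne
    have hsw := hc₀.swap hm2 h2 hwu h2u (hd c₀ hc₀) hv
    obtain ⟨z, hz, hzw, hzμ⟩ := key _ hsw (c₀ s(w, u))
      (hc₀.2.2 w u (by simp only [deleteEdges_adj, Set.mem_singleton_iff, Sym2.eq_iff]; grind)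
        (by simp only [Set.mem_insert_iff, Set.mem_singleton_iff]; grind))
      (fun y hy hy2 => by
        have := hd c₀ hc₀ u u hwu hn3.symm h2u hn2.symm
        have := hc₀.2.1 w y u
        simp only [deleteEdges_adj, Set.mem_singleton_iff, Sym2.eq_iff] at this
        simp only [Function.update_apply, Sym2.eq_iff]
        grind)
    refine ⟨z, hz, hzw, ?_⟩
    rwa [Function.update_of_ne (by simp only [ne_eq, Sym2.eq_iff]; grind),
      Function.update_of_ne (by simp only [ne_eq, Sym2.eq_iff]; grind)] at hzμ
  set P := insert (fv w) (((G.neighborFinset w).erase w₂).image fun y => c₀ s(w, y)) with hP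
  set T := ((G.neighborFinset w₄).erase w).image fun z => c₀ s(w₄, z)
  have hT' : ∀ {μ}, (∃ z, G.Adj w₄ z ∧ z ≠ w ∧ c₀ s(w₄, z) = μ) → μ ∈ T :=
    fun ⟨z, hz, hzw, hzμ⟩ => Finset.mem_image.2 ⟨z, by simp [hz, hzw], hzμ⟩
  have hPw : ∀ {u}, G.Adj w u → u ≠ w₂ → c₀ s(w, u) ∉ Pᶜ := fun {u} hu hu2 h =>
    Finset.mem_compl.1 h
      (Finset.mem_insert_of_mem (Finset.mem_image.2 ⟨u, by simp [hu, hu2], rfl⟩))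
  have hsub : insert (c₀ s(w, w₁)) (insert (c₀ s(w, w₃)) Pᶜ) ⊆ T := by
    refine Finset.insert_subset (hT' (hT w₁ h1 h12.symm h41))
      (Finset.insert_subset (hT' (hT w₃ h3 h23 h43)) fun μ hμ => hT' ?_)
    simp only [hP, Finset.mem_compl, Finset.mem_insert, Finset.mem_image, Finset.mem_erase,
      mem_neighborFinset, not_or, not_exists, not_and] at hμ
    exact key c₀ hc₀ μ (Ne.symm hμ.1) fun y hy hy2 => hμ.2 y ⟨hy2, hy⟩
  have hne : c₀ s(w, w₁) ≠ c₀ s(w, w₃) := by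
    have := h2.ne
    have := h12.ne
    have := h23.ne
    refine hc₀.2.1 w w₁ w₃ ?_ ?_ h13 <;>
      simp only [deleteEdges_adj, Set.mem_singleton_iff, Sym2.eq_iff] <;> grind
  have k := Finset.card_le_card hsub
  rw [Finset.card_insert_of_notMem, Finset.card_insert_of_notMem (hPw h3 h23.ne'),
    Finset.card_compl, Fintype.card_fin] at k
  · have k1 : P.card ≤ _ := Finset.card_insert_le _ _
    have k2 := Finset.card_image_le (s := (G.neighborFinset w).erase w₂)
      (f := fun y => c₀ s(w, y))
    have k3 : T.card ≤ _ := Finset.card_image_le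
    have k4 := card_neighborFinset_erase h2
    have k5 := card_neighborFinset_erase h4.symm
    lia
  · simpa [-Finset.mem_compl, hne] using hPw h1 h12.ne
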